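/- arXiv:1901.02859 — 2 statements merged into one kernel-verified Lean document; each statement's English description precedes it below -/
import Mathlib

section
/- Let a group G act on a set X, let 𝒟 be a G-lattice of subsets of X, let m be a mean on 𝒟, and let W ∈ 𝒟 with m(W) > 0. Then the thick-largeness condition L^thick_k(W) holds for every k ∈ ℕ. -/
open Pointwise

/-- A subset `D` of a group `G` is thick if there is `n ≥ 1` such that among any
`g₁, …, gₙ ∈ G` there are `i < j` with `gⱼ⁻¹ * gᵢ ∈ D`. -/
def IsThick {G : Type*} [Group G] (D : Set G) : Prop :=
  ∃ n : ℕ, 1 ≤ n ∧ ∀ g : Fin n → G, ∃ i j : Fin n, i < j ∧ (g j)⁻¹ * g i ∈ D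

/-- A `G`-lattice of subsets of a `G`-set `X`. -/
def IsGLattice (G : Type*) {X : Type*} [Group G] [MulAction G X] (D : Set (Set X)) : Prop :=
  ∅ ∈ D ∧ Set.univ ∈ D ∧ (∀ (g : G), ∀ Y ∈ D, g • Y ∈ D) ∧
    (∀ Y ∈ D, ∀ Z ∈ D, Y ∩ Z ∈ D) ∧ (∀ Y ∈ D, ∀ Z ∈ D, Y ∪ Z ∈ D)

/-- A mean on a `G`-lattice. -/
def IsMean (G : Type*) {X : Type*} [Group G] [MulAction G X] (D : Set (Set X))
    (m : Set X → ℝ) : Prop :=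
  (∀ Y ∈ D, 0 ≤ m Y) ∧ (∀ Y ∈ D, ∀ Z ∈ D, Y ⊆ Z → m Y ≤ m Z) ∧
    (∀ (g : G), ∀ Y ∈ D, m (g • Y) = m Y) ∧ m ∅ = 0 ∧
    (∀ Y ∈ D, ∀ Z ∈ D, m (Y ∪ Z) = m Y + m Z - m (Y ∩ Z))

/-- The thick-largeness predicates `L^thick_k`. -/
def LargeThick (G : Type*) {X : Type*} [Group G] [MulAction G X] : ℕ → Set X → Prop
  | 0, Y => Y.Nonempty
  | k + 1, Y => IsThick {g : G | LargeThick G k (g • Y ∩ Y)}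

section GLattice

variable {G X ι : Type*} [Group G] [MulAction G X] {D : Set (Set X)} {m : Set X → ℝ}

/-- A `G`-lattice is closed under finite unions. -/
lemma IsGLattice.biUnion_mem (hD : IsGLattice G D) (s : Finset ι) {f : ι → Set X}
    (hf : ∀ i, f i ∈ D) : (⋃ i ∈ s, f i) ∈ D := by
  classical
  induction s using Finset.induction_on with
  | empty => simpa using hD.1
  | insert a s _ ih =>
    rw [Finset.set_biUnion_insert]
    exact hD.2.2.2.2 _ (hf a) _ ih

/-- A mean is finitely subadditive. -/
lemma IsMean.biUnion_le (hD : IsGLattice G D) (hm : IsMean G D m) (s : Finset ι)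
    {f : ι → Set X} (hf : ∀ i, f i ∈ D) : m (⋃ i ∈ s, f i) ≤ ∑ i ∈ s, m (f i) := by
  classical
  obtain ⟨hnonneg, -, -, hempty, hmod⟩ := hm
  induction s using Finset.induction_on with
  | empty => simp [hempty]
  | insert a s ha ih =>
    have hU := hD.biUnion_mem s hf
    rw [Finset.set_biUnion_insert, Finset.sum_insert ha, hmod _ (hf a) _ hU]
    linarith [hnonneg _ (hD.2.2.2.1 _ (hf a) _ hU)]

/-- A mean is additive on finite families whose pairwise intersections are null. -/
lemma IsMean.biUnion_eq_sum (hD : IsGLattice G D) (hm : IsMean G D m) (s : Finset ι)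
    {f : ι → Set X} (hf : ∀ i, f i ∈ D) (hnull : Pairwise fun i j => m (f i ∩ f j) = 0) :
    m (⋃ i ∈ s, f i) = ∑ i ∈ s, m (f i) := by
  classical
  have hmean := hm
  obtain ⟨hnonneg, -, -, hempty, hmod⟩ := hm
  induction s using Finset.induction_on with
  | empty => simp [hempty]
  | insert a s ha ih =>
    have hU := hD.biUnion_mem s hf
    have hinter : m (f a ∩ ⋃ i ∈ s, f i) = 0 := by
      refine le_antisymm ?_ (hnonneg _ (hD.2.2.2.1 _ (hf a) _ hU))
      rw [Set.inter_iUnion₂]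
      refine (hmean.biUnion_le hD s fun i => hD.2.2.2.1 _ (hf a) _ (hf i)).trans_eq ?_
      exact Finset.sum_eq_zero fun i hi => hnull fun h => ha (h ▸ hi)
    rw [Finset.set_biUnion_insert, Finset.sum_insert ha, hmod _ (hf a) _ hU, hinter, ih, sub_zero]

/-- If `W` has positive mean, then the set of `g` for which `g • W ∩ W` has positive mean is
thick. -/
lemma IsMean.isThick_setOf_pos (hD : IsGLattice G D) (hm : IsMean G D m) {W : Set X}
    (hW : W ∈ D) (hWpos : 0 < m W) : IsThick {g : G | 0 < m (g • W ∩ W)} := by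
  have hmean := hm
  obtain ⟨hnonneg, hmono, hinv, -, -⟩ := hm
  obtain ⟨-, huniv, hsmul, hinter, -⟩ := id hD
  obtain ⟨n, hn⟩ := exists_nat_gt (m Set.univ / m W)
  have hn' : m Set.univ < n * m W := (div_lt_iff₀ hWpos).1 hn
  refine ⟨n, ?_, fun g => ?_⟩
  · exact_mod_cast (div_nonneg (hnonneg _ huniv) hWpos.le).trans_lt hn
  by_contra! hcon
  have hlt : ∀ i j, i < j → m (g i • W ∩ g j • W) = 0 := fun i j hij => by
    have hmem := hinter _ (hsmul ((g j)⁻¹ * g i) _ hW) _ hW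
    have htrans : g j • (((g j)⁻¹ * g i) • W ∩ W) = g i • W ∩ g j • W := by
      rw [Set.smul_set_inter, smul_smul, mul_inv_cancel_left]
    rw [← htrans, hinv _ _ hmem]
    exact le_antisymm (not_lt.1 (hcon i j hij)) (hnonneg _ hmem)
  have hnull : Pairwise fun i j => m (g i • W ∩ g j • W) = 0 := fun i j hij => by
    rcases hij.lt_or_gt with h | h
    · exact hlt i j h
    · rw [Set.inter_comm]
      exact hlt j i h
  have hf : ∀ i, g i • W ∈ D := fun i => hsmul _ _ hW
  have hsum := hmean.biUnion_eq_sum hD Finset.univ hf hnull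
  simp only [hinv _ _ hW, Finset.sum_const, Finset.card_univ, Fintype.card_fin,
    nsmul_eq_mul] at hsum
  linarith [hmono _ (hD.biUnion_mem Finset.univ hf) _ huniv (Set.subset_univ _)]

end GLattice

/-- Thickness passes to supersets. -/
lemma IsThick.mono {G : Type*} [Group G] {A B : Set G} (hA : IsThick A) (hAB : A ⊆ B) :
    IsThick B := by
  obtain ⟨n, hn, h⟩ := hA
  refine ⟨n, hn, fun g => ?_⟩
  obtain ⟨i, j, hij, hmem⟩ := h g
  exact ⟨i, j, hij, hAB hmem⟩

/-- Lemma 2.7(2), thick variant: if `m` is a mean on a `G`-lattice `D` and `W ∈ D` has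
positive mean, then `L^thick_k(W)` holds for all `k`. -/
theorem largeThick_of_mean_pos {G X : Type*} [Group G] [MulAction G X]
    (D : Set (Set X)) (m : Set X → ℝ)
    (hD : IsGLattice G D) (hm : IsMean G D m)
    (W : Set X) (hW : W ∈ D) (hWpos : 0 < m W) :
    ∀ k : ℕ, LargeThick G k W := by
  intro k
  induction k generalizing W with
  | zero =>
    refine Set.nonempty_iff_ne_empty.2 fun h => ?_
    rw [h, hm.2.2.2.1] at hWpos
    exact hWpos.false
  | succ k ih =>
    exact (hm.isThick_setOf_pos hD hW hWpos).mono fun g hg =>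
      ih _ (hD.2.2.2.1 _ (hD.2.2.1 g _ hW) _ hW) hg
end

section
/- Let G be a group, H a subgroup of G, and B a subset of G with h·B = B and B·h = B for every h ∈ H. Then for every k ∈ ℕ, the set S := {g ∈ G : L_k(gB ∩ B)} (generic largeness for the left-multiplication action of G on itself) satisfies H·S·H = S; that is, for all h₁, h₂ ∈ H and g ∈ G, h₁gh₂ ∈ S if and only if g ∈ S. -/
open Pointwise

/-- A subset `D` of a group `G` is generic if finitely many left translates of `D` cover `G`. -/
def IsGeneric {G : Type*} [Group G] (D : Set G) : Prop :=
  ∃ F : Finset G, ∀ g : G, ∃ h ∈ F, h⁻¹ * g ∈ D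

/-- The generic-largeness predicates `L_k` (for the left-multiplication action of `G` on
itself). -/
def LargeGen (G : Type*) {X : Type*} [Group G] [MulAction G X] : ℕ → Set X → Prop
  | 0, Y => Y.Nonempty
  | k + 1, Y => IsGeneric {g : G | LargeGen G k (g • Y ∩ Y)}

/-- Conjugates of generic sets are generic. -/
theorem IsGeneric.preimage_conj {G : Type*} [Group G] {D : Set G} (hD : IsGeneric D) (a : G) :
    IsGeneric {g : G | a⁻¹ * g * a ∈ D} := by
  classical
  obtain ⟨F, hF⟩ := hD
  refine ⟨F.image fun f => a * f * a⁻¹, fun g => ?_⟩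
  obtain ⟨f, hf, hfD⟩ := hF (a⁻¹ * g * a)
  refine ⟨_, Finset.mem_image_of_mem _ hf, ?_⟩
  simpa [mul_assoc] using hfD

/-- Generic largeness is preserved by translation. -/
theorem LargeGen.smul {G X : Type*} [Group G] [MulAction G X] {k : ℕ} {Y : Set X}
    (hY : LargeGen G k Y) (a : G) : LargeGen G k (a • Y) := by
  induction k generalizing Y a with
  | zero => exact Set.Nonempty.smul_set hY
  | succ k ih =>
    obtain ⟨F, hF⟩ := IsGeneric.preimage_conj hY a
    refine ⟨F, fun g => ?_⟩
    obtain ⟨f, hf, hfD⟩ := hF g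
    refine ⟨f, hf, ?_⟩
    simpa only [Set.mem_ofPred_eq, Set.smul_set_inter, smul_smul, mul_assoc, mul_inv_cancel_left]
      using ih hfD a

theorem largeGen_smul_iff {G X : Type*} [Group G] [MulAction G X] {k : ℕ} {Y : Set X} (a : G) :
    LargeGen G k (a • Y) ↔ LargeGen G k Y :=
  ⟨fun h => by simpa only [inv_smul_smul] using h.smul a⁻¹, fun h => h.smul a⟩

/-- The bi-invariance assertion from the proof of the Claim in Lemma 4.31 (semantic form):
if `H` is a subgroup of `G` and `B ⊆ G` satisfies `hB = B` and `Bh = B` for all `h ∈ H`,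
then for every `k` the set `S = {g : L_k(gB ∩ B)}` satisfies `H·S·H = S`. -/
theorem largeness_stabilizer_biinvariant {G : Type*} [Group G]
    (H : Subgroup G) (B : Set G)
    (hleft : ∀ h ∈ H, h • B = B) (hright : ∀ h ∈ H, B * {h} = B) :
    ∀ k : ℕ, ∀ h₁ ∈ H, ∀ h₂ ∈ H, ∀ g : G,
      (h₁ * g * h₂) ∈ {g' : G | LargeGen G k (g' • B ∩ B)} ↔
        g ∈ {g' : G | LargeGen G k (g' • B ∩ B)} := by
  intro k h₁ hh₁ h₂ hh₂ g
  have key : (h₁ * g * h₂) • B ∩ B = h₁ • (g • B ∩ B) := by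
    rw [Set.smul_set_inter, hleft h₁ hh₁, mul_smul, mul_smul, hleft h₂ hh₂]
  rw [Set.mem_ofPred_eq, Set.mem_ofPred_eq, key, largeGen_smul_iff]
end
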